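/- arXiv:2508.07001 — 3 statements merged into one kernel-verified Lean document; each statement's English description precedes it below -/
import Mathlib

section
/- Let N ≥ 2, let 𝒢 be a connected simple graph on {1,…,N}, let ν > 0, and let L be an N×N doubly stochastic matrix with ℓ_ii ≥ ν for every i and ℓ_ij ≥ ν for every edge {i,j} of 𝒢. Then for every natural number G and all indices i, j, |(L^G)_{ij} − 1/N| ≤ (1 − N·ν^(N−1))^⌊G/(N−1)⌋. -/
open Finset

/-- Powers of a nonnegative matrix bounded below by `ν` on the diagonal and on the edges of a graph
are bounded below by powers of `ν` at the endpoints of any sufficiently short walk. -/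
lemma pow_le_matrix_pow_apply_of_walk {V : Type*} [Fintype V] [DecidableEq V]
    {𝒢 : SimpleGraph V} {ν : ℝ} (hν : 0 ≤ ν) {L : Matrix V V ℝ}
    (hnonneg : ∀ i j, 0 ≤ L i j) (hdiag : ∀ i, ν ≤ L i i)
    (hadj : ∀ i j, 𝒢.Adj i j → ν ≤ L i j) (k : ℕ) {i j : V} (p : 𝒢.Walk i j)
    (hp : p.length ≤ k) : ν ^ k ≤ (L ^ k) i j := by
  have hpow : ∀ k i j, 0 ≤ (L ^ k) i j := by
    intro k
    induction k with
    | zero => intro i j; rw [pow_zero, Matrix.one_apply]; split_ifs <;> norm_num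
    | succ k ih =>
      intro i j
      rw [pow_succ', Matrix.mul_apply]
      exact sum_nonneg fun l _ => mul_nonneg (hnonneg i l) (ih l j)
  have step : ∀ k i l j, ν ≤ L i l → ν ^ k ≤ (L ^ k) l j → ν ^ (k + 1) ≤ (L ^ (k + 1)) i j := by
    intro k i l j h₁ h₂
    rw [pow_succ', pow_succ', Matrix.mul_apply]
    calc ν * ν ^ k ≤ L i l * (L ^ k) l j :=
          mul_le_mul h₁ h₂ (pow_nonneg hν k) (hnonneg i l)
      _ ≤ _ := single_le_sum (f := fun l => L i l * (L ^ k) l j)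
          (fun l _ => mul_nonneg (hnonneg i l) (hpow k l j)) (mem_univ l)
  induction k generalizing i with
  | zero =>
    obtain rfl := SimpleGraph.Walk.eq_of_length_eq_zero (Nat.le_zero.mp hp)
    simp
  | succ k ih =>
    cases p with
    | nil => exact step k j j j (hdiag j) (ih .nil (Nat.zero_le k))
    | cons h p =>
      exact step k i _ j (hadj _ _ h) (ih p (by simpa using hp))

/-- Left multiplication by a row-stochastic matrix with entries at least `ε` contracts the
entrywise distance to the uniform matrix by the factor `1 - N * ε`, among matrices with column
sums `1`. -/
lemma abs_mul_apply_sub_le {V : Type*} [Fintype V] [Nonempty V] {P M : Matrix V V ℝ} {ε C : ℝ}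
    (hε : ∀ i j, ε ≤ P i j) (hrow : ∀ i, ∑ j, P i j = 1) (hcol : ∀ j, ∑ i, M i j = 1)
    (hC : ∀ i j, |M i j - 1 / Fintype.card V| ≤ C) (i j : V) :
    |(P * M) i j - 1 / Fintype.card V| ≤ (1 - Fintype.card V * ε) * C := by
  have hN : (Fintype.card V : ℝ) ≠ 0 := by simp
  have h : (P * M) i j - 1 / Fintype.card V
      = ∑ l, (P i l - ε) * (M l j - 1 / Fintype.card V) := by
    simp only [Matrix.mul_apply, sub_mul, mul_sub, sum_sub_distrib, ← sum_mul, ← mul_sum, hrow,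
      hcol, sum_const, card_univ, nsmul_eq_mul]
    field_simp
    ring
  calc |(P * M) i j - 1 / Fintype.card V|
      ≤ ∑ l, |(P i l - ε) * (M l j - 1 / Fintype.card V)| := h ▸ abs_sum_le_sum_abs _ _
    _ ≤ ∑ l, (P i l - ε) * C := by
        refine sum_le_sum fun l _ => ?_
        have hl := sub_nonneg.mpr (hε i l)
        rw [abs_mul, abs_of_nonneg hl]
        exact mul_le_mul_of_nonneg_left (hC l j) hl
    _ = (1 - Fintype.card V * ε) * C := by
        rw [← sum_mul, sum_sub_distrib, hrow]
        simp


/-- For a doubly stochastic consensus matrix `L` over a connected graph, with `L i i ≥ ν`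
and `L i j ≥ ν` on edges, every entry of `L ^ G` is within
`(1 - N·ν^(N-1))^⌊G/(N-1)⌋` of `1/N`. -/
theorem stmt_2 (N : ℕ) (hN : 2 ≤ N) (𝒢 : SimpleGraph (Fin N)) (hconn : 𝒢.Connected)
    (ν : ℝ) (hν : 0 < ν) (L : Matrix (Fin N) (Fin N) ℝ)
    (hnonneg : ∀ i j, 0 ≤ L i j)
    (hrow : ∀ i, ∑ j, L i j = 1)
    (hcol : ∀ j, ∑ i, L i j = 1)
    (hdiag : ∀ i, ν ≤ L i i)
    (hadj : ∀ i j, 𝒢.Adj i j → ν ≤ L i j) :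
    ∀ (G : ℕ) (i j : Fin N),
      |(L ^ G) i j - 1 / N| ≤ (1 - (N : ℝ) * ν ^ (N - 1)) ^ (G / (N - 1)) := by
  have hds : L ∈ doublyStochastic ℝ (Fin N) :=
    mem_doublyStochastic_iff_sum.mpr ⟨hnonneg, hrow, hcol⟩
  have : NeZero N := ⟨by lia⟩
  have hlow : ∀ i j, ν ^ (N - 1) ≤ (L ^ (N - 1)) i j := by
    intro i j
    obtain ⟨p, hp⟩ := (hconn.preconnected i j).exists_isPath
    have hlen := hp.length_lt
    rw [Fintype.card_fin] at hlen
    exact pow_le_matrix_pow_apply_of_walk hν.le hnonneg hdiag hadj _ p (by lia)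
  have key : ∀ k r i j, |((L ^ (N - 1)) ^ k * L ^ r) i j - 1 / N|
      ≤ (1 - (N : ℝ) * ν ^ (N - 1)) ^ k := by
    intro k r
    induction k with
    | zero =>
      intro i j
      have h₀ := nonneg_of_mem_doublyStochastic (pow_mem hds r) (i := i) (j := j)
      have h₁ := le_one_of_mem_doublyStochastic (pow_mem hds r) (i := i) (j := j)
      have hN₀ : (0 : ℝ) ≤ 1 / N := by positivity
      have hN₁ : (1 : ℝ) / N ≤ 1 := by simpa using Nat.cast_inv_le_one (α := ℝ) N
      rw [pow_zero, pow_zero, one_mul, abs_le]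
      constructor <;> linarith
    | succ k ih =>
      intro i j
      rw [pow_succ', pow_succ', mul_assoc]
      simpa only [Fintype.card_fin] using abs_mul_apply_sub_le hlow
        (sum_row_of_mem_doublyStochastic (pow_mem hds _))
        (sum_col_of_mem_doublyStochastic (mul_mem (pow_mem (pow_mem hds _) k) (pow_mem hds r)))
        (by simpa only [Fintype.card_fin] using ih) i j
  intro G i j
  have h := key (G / (N - 1)) (G % (N - 1)) i j
  rwa [← pow_mul, ← pow_add, Nat.div_add_mod] at h
end

section
/- Let N ≥ 2, let 𝒢 be a connected simple graph on {1,…,N}, let ν > 0, and let L be an N×N doubly stochastic matrix with ℓ_ii ≥ ν for every i and ℓ_ij ≥ ν for every edge {i,j} of 𝒢. Let r_max > 0 and let r ∈ ℝ^N satisfy |r_i| ≤ r_max for all i. Then for every natural number G and every index i, |(L^G r)_i − r̄| ≤ 2·r_max·(1 − N·ν^(N−1))^⌊G/(N−1)⌋, where r̄ = (1/N)∑_{j=1}^N r_j. -/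
open Matrix Finset

/-- A walk of length at most `k` gives the lower bound `ν ^ k` on the corresponding entry of the
`k`-th power of a nonnegative matrix with diagonal and edge entries at least `ν`. -/
theorem pow_le_matrix_pow_apply_of_walk_s3 {n : Type*} [Fintype n] [DecidableEq n]
    {H : SimpleGraph n} {ν : ℝ} (hν : 0 ≤ ν) {A : Matrix n n ℝ} (hA : ∀ i j, 0 ≤ A i j)
    (hdiag : ∀ i, ν ≤ A i i) (hadj : ∀ i j, H.Adj i j → ν ≤ A i j) (k : ℕ) :
    ∀ {i j : n} (w : H.Walk i j), w.length ≤ k → ν ^ k ≤ (A ^ k) i j := by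
  have hpow : ∀ (m : ℕ) (i j : n), 0 ≤ (A ^ m) i j := by
    intro m
    induction m with
    | zero =>
      intro i j
      rw [pow_zero, Matrix.one_apply]
      split_ifs <;> norm_num
    | succ m ih =>
      intro i j
      rw [pow_succ', Matrix.mul_apply]
      exact sum_nonneg fun l _ => mul_nonneg (hA i l) (ih l j)
  induction k with
  | zero =>
    intro i j w hw
    obtain rfl := SimpleGraph.Walk.eq_of_length_eq_zero (Nat.le_zero.mp hw)
    simp
  | succ k ih =>
    have step : ∀ {i l j : n}, ν ≤ A i l → ν ^ k ≤ (A ^ k) l j →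
        ν ^ (k + 1) ≤ (A ^ (k + 1)) i j := by
      intro i l j h₁ h₂
      rw [pow_succ', pow_succ', Matrix.mul_apply]
      exact (mul_le_mul h₁ h₂ (pow_nonneg hν k) (hA i l)).trans
        (single_le_sum (f := fun m => A i m * (A ^ k) m j)
          (fun m _ => mul_nonneg (hA i m) (hpow k m j)) (mem_univ l))
    intro i j w hw
    cases w with
    | nil => exact step (hdiag i) (ih .nil (Nat.zero_le k))
    | cons h p => exact step (hadj _ _ h) (ih p (by simpa using hw))

/-- A row-stochastic matrix whose entries are all at least `δ` contracts zero-sum vectors in the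
sup norm by the factor `1 - card n * δ`. -/
theorem abs_mulVec_le_of_sum_eq_zero {n : Type*} [Fintype n] {A : Matrix n n ℝ} {δ c : ℝ}
    (hrow : ∀ i, ∑ j, A i j = 1) (hδ : ∀ i j, δ ≤ A i j) {y : n → ℝ} (hsum : ∑ j, y j = 0)
    (hy : ∀ j, |y j| ≤ c) (i : n) : |(A *ᵥ y) i| ≤ (1 - Fintype.card n * δ) * c := by
  have h : (A *ᵥ y) i = ∑ j, (A i j - δ) * y j := by
    simp [Matrix.mulVec, dotProduct, sub_mul, sum_sub_distrib, ← mul_sum, hsum]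
  calc |(A *ᵥ y) i| ≤ ∑ j, |(A i j - δ) * y j| := h ▸ abs_sum_le_sum_abs _ _
    _ ≤ ∑ j, (A i j - δ) * c := sum_le_sum fun j _ => by
        rw [abs_mul, abs_of_nonneg (sub_nonneg.2 (hδ i j))]
        exact mul_le_mul_of_nonneg_left (hy j) (sub_nonneg.2 (hδ i j))
    _ = (1 - Fintype.card n * δ) * c := by
        rw [← sum_mul, sum_sub_distrib, hrow]; simp

/-- Iterating a doubly stochastic matrix whose entries are all at least `δ` contracts zero-sum
vectors geometrically. -/
theorem abs_pow_mulVec_le_of_sum_eq_zero {n : Type*} [Fintype n] [DecidableEq n]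
    {A : Matrix n n ℝ} (hA : A ∈ doublyStochastic ℝ n) {δ c : ℝ} (hδ : ∀ i j, δ ≤ A i j)
    {y : n → ℝ} (hsum : ∑ j, y j = 0) (hy : ∀ j, |y j| ≤ c) (q : ℕ) (i : n) :
    |((A ^ q) *ᵥ y) i| ≤ (1 - Fintype.card n * δ) ^ q * c := by
  induction q generalizing i with
  | zero => simpa using hy i
  | succ q ih =>
    rw [pow_succ', pow_succ', ← Matrix.mulVec_mulVec, mul_assoc]
    refine abs_mulVec_le_of_sum_eq_zero (fun i => sum_row_of_mem_doublyStochastic hA i) hδ ?_ ih i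
    rw [sum_mulVec_of_mem_doublyStochastic (pow_mem hA q), hsum]


/-- Reward consensus error after `G` rounds: for a doubly stochastic consensus matrix `L`
over a connected graph (with `ν`-lower-bounded diagonal and edge entries) and a reward
vector `r` bounded by `r_max`, each entry of `L^G r` is within
`2·r_max·(1 - N·ν^(N-1))^⌊G/(N-1)⌋` of the global average `r̄ = (1/N)∑ⱼ rⱼ`. -/
theorem stmt_3 (N : ℕ) (hN : 2 ≤ N) (𝒢 : SimpleGraph (Fin N)) (hconn : 𝒢.Connected)
    (ν : ℝ) (hν : 0 < ν) (L : Matrix (Fin N) (Fin N) ℝ)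
    (hnonneg : ∀ i j, 0 ≤ L i j)
    (hrow : ∀ i, ∑ j, L i j = 1)
    (hcol : ∀ j, ∑ i, L i j = 1)
    (hdiag : ∀ i, ν ≤ L i i)
    (hadj : ∀ i j, 𝒢.Adj i j → ν ≤ L i j)
    (r_max : ℝ) (hr_max : 0 < r_max)
    (r : Fin N → ℝ) (hr : ∀ i, |r i| ≤ r_max) :
    ∀ (G : ℕ) (i : Fin N),
      |((L ^ G).mulVec r) i - (1 / N) * ∑ j, r j|
        ≤ 2 * r_max * (1 - (N : ℝ) * ν ^ (N - 1)) ^ (G / (N - 1)) := by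
  intro G i
  have hL : L ∈ doublyStochastic ℝ (Fin N) :=
    mem_doublyStochastic_iff_sum.2 ⟨hnonneg, hrow, hcol⟩
  have hN0 : (0 : ℝ) < N := by exact_mod_cast (by omega : 0 < N)
  have hentry : ∀ i j, ν ^ (N - 1) ≤ (L ^ (N - 1)) i j := by
    intro i j
    obtain ⟨w, hw⟩ := (hconn i j).exists_isPath
    have hlt := hw.length_lt
    rw [Fintype.card_fin] at hlt
    exact pow_le_matrix_pow_apply_of_walk_s3 hν.le hnonneg hdiag hadj (N - 1) w (by omega)
  set μ : ℝ := (1 / N) * ∑ j, r j with hμ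
  have hμ_abs : |μ| ≤ r_max := by
    have h : |∑ j, r j| ≤ N * r_max := by
      simpa using (abs_sum_le_sum_abs r univ).trans (sum_le_sum fun j _ => hr j)
    rw [hμ, abs_mul, abs_of_pos (one_div_pos.2 hN0), one_div, inv_mul_le_iff₀ hN0]
    exact h
  let y : Fin N → ℝ := fun j => r j - μ
  have hy_sum : ∑ j, y j = 0 := by
    simp only [y, sum_sub_distrib, sum_const, card_univ, Fintype.card_fin, nsmul_eq_mul, hμ]
    field_simp
    ring
  have hy : ∀ j, |y j| ≤ 2 * r_max := fun j =>
    (abs_sub _ _).trans (by linarith [hr j])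
  have hcenter : ((L ^ G) *ᵥ r) i - μ = ((L ^ G) *ᵥ y) i := by
    simp [y, Matrix.mulVec, dotProduct, mul_sub, sum_sub_distrib, ← sum_mul,
      sum_row_of_mem_doublyStochastic (pow_mem hL G)]
  have hsplit : L ^ G = (L ^ (N - 1)) ^ (G / (N - 1)) * L ^ (G % (N - 1)) := by
    rw [← pow_mul, ← pow_add, Nat.div_add_mod]
  rw [hcenter, hsplit, ← Matrix.mulVec_mulVec, mul_comm (2 * r_max)]
  have hrem := pow_mem hL (G % (N - 1))
  have h := abs_pow_mulVec_le_of_sum_eq_zero (pow_mem hL (N - 1)) hentry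
    (y := (L ^ (G % (N - 1))) *ᵥ y) (c := 2 * r_max)
    (by rw [sum_mulVec_of_mem_doublyStochastic hrem, hy_sum])
    (fun j => by
      simpa using abs_mulVec_le_of_sum_eq_zero (δ := 0)
        (fun i => sum_row_of_mem_doublyStochastic hrem i)
        (fun i j => nonneg_of_mem_doublyStochastic hrem) hy_sum hy j)
    (G / (N - 1)) i
  rwa [Fintype.card_fin] at h
end

section
/- Let N ≥ 2, let 𝒢 be a connected simple graph on {1,…,N}, let ν > 0, and let L be an N×N doubly stochastic matrix with ℓ_ii ≥ ν for every i and ℓ_ij ≥ ν for every edge {i,j} of 𝒢. Let r_max > 0 and let r ∈ ℝ^N satisfy |r_i| ≤ r_max for all i. Then for every natural number G and every index i, |(L^G r)_i − r̄| ≤ 2·N·r_max·(1 + ν^(−(N−1)))·(1 − ν^(N−1))^G, where r̄ = (1/N)∑_{j=1}^N r_j. -/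
open Finset

/-- In a connected graph on at least three vertices, some vertex has two distinct neighbours. -/
lemma SimpleGraph.Connected.exists_adj_adj_ne {V : Type*} [Fintype V] [DecidableEq V]
    {G : SimpleGraph V} (hG : G.Connected) (hV : 3 ≤ Fintype.card V) :
    ∃ k a b, a ≠ b ∧ G.Adj k a ∧ G.Adj k b := by
  have : Nontrivial V := Fintype.one_lt_card_iff_nontrivial.mp (by omega)
  obtain ⟨u⟩ := hG.nonempty
  obtain ⟨v, huv⟩ := hG.preconnected.exists_adj_of_nontrivial u
  obtain ⟨z, hz⟩ : ∃ z, z ∉ ({u, v} : Finset V) := by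
    by_contra! h
    have := (card_le_card fun z _ => h z : #(univ : Finset V) ≤ _).trans card_le_two
    rw [card_univ] at this
    omega
  obtain ⟨p⟩ := hG.preconnected u z
  obtain ⟨d, -, hd, hd'⟩ := p.exists_boundary_dart (({u, v} : Finset V) : Set V) (by simp)
    (by simpa using hz)
  have hadj := d.adj
  simp only [coe_insert, coe_singleton, Set.mem_insert_iff, Set.mem_singleton_iff, not_or]
    at hd hd'
  rcases hd with h | h
  · exact ⟨u, v, d.snd, fun e => hd'.2 e.symm, huv, h ▸ hadj⟩
  · exact ⟨v, u, d.snd, fun e => hd'.1 e.symm, huv.symm, h ▸ hadj⟩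

/-- Cauchy–Schwarz along a path: the squared difference of endpoint values is controlled by the
energy of the vertices visited. -/
lemma SimpleGraph.Walk.IsPath.sq_sub_le_energy {V : Type*} [DecidableEq V]
    {G : SimpleGraph V} (x : V → ℝ) (w : V → V → ℝ) (c : ℝ) (hw : ∀ a b, 0 ≤ w a b)
    (hc : ∀ a b, G.Adj a b → c * (x a - x b) ^ 2 ≤ w a b) {u v : V} (p : G.Walk u v)
    (hp : p.IsPath) :
    2 * c * (x u - x v) ^ 2 ≤
      p.length * ∑ a ∈ p.support.toFinset, ∑ b ∈ p.support.toFinset, w a b := by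
  by_cases hc0 : c < 0
  · have h1 : 0 ≤ (p.length : ℝ) *
        ∑ a ∈ p.support.toFinset, ∑ b ∈ p.support.toFinset, w a b :=
      mul_nonneg (by positivity) (sum_nonneg fun a _ => sum_nonneg fun b _ => hw a b)
    nlinarith [sq_nonneg (x u - x v)]
  push Not at hc0
  induction p with
  | nil => simp
  | @cons u v z h p ih =>
    rw [SimpleGraph.Walk.cons_isPath_iff] at hp
    have ih := ih hp.1
    have hu : u ∉ p.support.toFinset := by simpa using hp.2
    have hv : v ∈ p.support.toFinset := by simp
    rw [SimpleGraph.Walk.support_cons, List.toFinset_cons, SimpleGraph.Walk.length_cons]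
    set S := p.support.toFinset
    set T := ∑ a ∈ S, ∑ b ∈ S, w a b
    have hsum : 2 * c * (x u - x v) ^ 2 + T ≤
        ∑ a ∈ insert u S, ∑ b ∈ insert u S, w a b := by
      simp only [sum_insert hu, sum_add_distrib]
      have h1 := single_le_sum (f := fun b => w u b) (fun b _ => hw u b) hv
      have h2 := single_le_sum (f := fun b => w b u) (fun b _ => hw b u) hv
      have h3 := hc u v h
      have h4 := hc v u h.symm
      have h5 : (x v - x u) ^ 2 = (x u - x v) ^ 2 := by ring
      rw [h5] at h4
      have := hw u u
      linarith
    have hn : (0 : ℝ) ≤ p.length := by positivity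
    push_cast
    refine le_trans ?_ (mul_le_mul_of_nonneg_left hsum (by positivity))
    set n : ℝ := (p.length : ℝ)
    rcases hn.eq_or_lt with h0 | h0
    · have hT : 0 ≤ T := sum_nonneg fun a _ => sum_nonneg fun b _ => hw a b
      have : p.length = 0 := Nat.cast_eq_zero.mp h0.symm
      have hvz := SimpleGraph.Walk.eq_of_length_eq_zero this
      rw [← h0, ← hvz]
      linarith
    · set s := x u - x v
      set t := x v - x z
      have hst : x u - x z = s + t := by simp only [s, t]; ring
      rw [hst]
      refine le_of_mul_le_mul_left ?_ h0
      have h1 := mul_le_mul_of_nonneg_left ih (by positivity : 0 ≤ n + 1)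
      have h2 : 0 ≤ 2 * c * (n * s - t) ^ 2 := by positivity
      nlinarith

lemma sum_sq_le_sum_sq_sub {V : Type*} [Fintype V] (y : V → ℝ) (hy : ∑ i, y i = 0) (c : ℝ) :
    ∑ i, y i ^ 2 ≤ ∑ i, (y i - c) ^ 2 := by
  have : ∑ i, (y i - c) ^ 2 = ∑ i, y i ^ 2 - 2 * c * ∑ i, y i + ∑ _i : V, c ^ 2 := by
    rw [mul_sum, ← sum_sub_distrib, ← sum_add_distrib]
    exact sum_congr rfl fun i _ => by ring
  rw [this, hy]
  have : 0 ≤ ∑ _i : V, c ^ 2 := by positivity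
  linarith

/-- **Popoviciu's inequality** for a finite family with zero sum. -/
lemma four_mul_sum_sq_le_card_mul {V : Type*} [Fintype V] [Nonempty V] (y : V → ℝ)
    (hy : ∑ i, y i = 0) (D : ℝ) (hD : ∀ i j, (y i - y j) ^ 2 ≤ D) :
    4 * ∑ i, y i ^ 2 ≤ Fintype.card V * D := by
  obtain ⟨a, ha⟩ := Finite.exists_max y
  obtain ⟨b, hb⟩ := Finite.exists_min y
  have h : ∑ i, (y i - (y a + y b) / 2) ^ 2 ≤ ∑ _i : V, D / 4 := by
    refine sum_le_sum fun i _ => ?_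
    nlinarith [ha i, hb i, hD a b, mul_nonneg (sub_nonneg.2 (ha i)) (sub_nonneg.2 (hb i))]
  have h' := sum_sq_le_sum_sq_sub y hy ((y a + y b) / 2)
  rw [sum_const, card_univ, nsmul_eq_mul] at h
  linarith

section Energy

variable {V : Type*} [Fintype V]

/-- The `(i, j)` term of the Dirichlet form of `Lᵀ * L`. -/
def dissipation (L : Matrix V V ℝ) (y : V → ℝ) (i j : V) : ℝ :=
  (∑ k, L k i * L k j) * (y i - y j) ^ 2

lemma dissipation_nonneg {L : Matrix V V ℝ} (hnonneg : ∀ i j, 0 ≤ L i j) (y : V → ℝ) (i j : V) :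
    0 ≤ dissipation L y i j :=
  mul_nonneg (sum_nonneg fun _ _ => mul_nonneg (hnonneg _ _) (hnonneg _ _)) (sq_nonneg _)

lemma sum_dissipation {L : Matrix V V ℝ} (hrow : ∀ i, ∑ j, L i j = 1)
    (hcol : ∀ j, ∑ i, L i j = 1) (y : V → ℝ) :
    ∑ i, ∑ j, dissipation L y i j = 2 * ∑ i, y i ^ 2 - 2 * ∑ k, (L.mulVec y k) ^ 2 := by
  have hk (k : V) : ∑ i, ∑ j, L k i * L k j * (y i - y j) ^ 2 =
      2 * ∑ i, L k i * y i ^ 2 - 2 * (L.mulVec y k) ^ 2 := by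
    have h (i : V) : ∑ j, L k i * L k j * (y i - y j) ^ 2 =
        L k i * y i ^ 2 * ∑ j, L k j - 2 * (L k i * y i) * ∑ j, L k j * y j
          + L k i * ∑ j, L k j * y j ^ 2 := by
      simp only [mul_sum, ← sum_sub_distrib, ← sum_add_distrib]
      exact sum_congr rfl fun j _ => by ring
    simp only [h, sum_add_distrib, sum_sub_distrib, ← sum_mul, ← mul_sum, hrow, Matrix.mulVec,
      dotProduct]
    ring
  calc ∑ i, ∑ j, dissipation L y i j
      = ∑ k, ∑ i, ∑ j, L k i * L k j * (y i - y j) ^ 2 := by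
        simp only [dissipation, sum_mul]
        rw [sum_congr rfl fun i _ => sum_comm, sum_comm]
    _ = _ := by
        simp only [hk, sum_sub_distrib, ← mul_sum]
        rw [sum_comm]
        simp only [← sum_mul, hcol, one_mul]

lemma two_mul_sq_le_dissipation [DecidableEq V] {L : Matrix V V ℝ} {ν : ℝ} (hν : 0 < ν)
    (hnonneg : ∀ i j, 0 ≤ L i j) (hdiag : ∀ i, ν ≤ L i i) {G : SimpleGraph V}
    (hadj : ∀ i j, G.Adj i j → ν ≤ L i j) (y : V → ℝ) (i j : V) (h : G.Adj i j) :
    2 * ν ^ 2 * (y i - y j) ^ 2 ≤ dissipation L y i j := by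
  refine mul_le_mul_of_nonneg_right ?_ (sq_nonneg _)
  have h1 : ∑ k ∈ {i, j}, L k i * L k j ≤ ∑ k, L k i * L k j :=
    sum_le_sum_of_subset_of_nonneg (subset_univ _)
      fun _ _ _ => mul_nonneg (hnonneg _ _) (hnonneg _ _)
  rw [sum_pair h.ne] at h1
  have h2 : ν * ν ≤ L i i * L i j := mul_le_mul (hdiag i) (hadj i j h) hν.le (hnonneg _ _)
  have h3 : ν * ν ≤ L j i * L j j := mul_le_mul (hadj j i h.symm) (hdiag j) hν.le (hnonneg _ _)
  linarith

lemma le_one_third [DecidableEq V] {L : Matrix V V ℝ} {ν : ℝ}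
    (hnonneg : ∀ i j, 0 ≤ L i j) (hrow : ∀ i, ∑ j, L i j = 1) (hdiag : ∀ i, ν ≤ L i i)
    {G : SimpleGraph V} (hadj : ∀ i j, G.Adj i j → ν ≤ L i j) {k a b : V} (hab : a ≠ b)
    (ha : G.Adj k a) (hb : G.Adj k b) : ν ≤ 1 / 3 := by
  have h : ∑ j ∈ {k, a, b}, L k j ≤ ∑ j, L k j :=
    sum_le_sum_of_subset_of_nonneg (subset_univ _) fun _ _ _ => hnonneg _ _
  rw [hrow, sum_insert (by simp [ha.ne, hb.ne]), sum_pair hab] at h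
  linarith [hdiag k, hadj k a ha, hadj k b hb]

lemma add_four_mul_add_three_le_four_mul_three_pow (m : ℕ) : (m + 4) * (m + 3) ≤ 4 * 3 ^ (m + 1) := by
  induction m with
  | zero => norm_num
  | succ m ih => rw [pow_succ]; nlinarith

/-- Poincaré inequality for graphs with at least four vertices. -/
lemma four_mul_pow_mul_le_of_four_le [DecidableEq V] {L : Matrix V V ℝ} {ν : ℝ} (hν : 0 < ν)
    (hnonneg : ∀ i j, 0 ≤ L i j) (hrow : ∀ i, ∑ j, L i j = 1)
    (hdiag : ∀ i, ν ≤ L i i) {G : SimpleGraph V} (hG : G.Connected)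
    (hadj : ∀ i j, G.Adj i j → ν ≤ L i j) (hV : 4 ≤ Fintype.card V) (y : V → ℝ)
    (hy : ∑ i, y i = 0) :
    4 * ν ^ (Fintype.card V - 1) * ∑ i, y i ^ 2 ≤ ∑ i, ∑ j, dissipation L y i j := by
  have : Nonempty V := hG.nonempty
  obtain ⟨k, a, b, hab, ha, hb⟩ := hG.exists_adj_adj_ne (by omega)
  have hν3 := le_one_third hnonneg hrow hdiag hadj hab ha hb
  obtain ⟨m, hm⟩ := Nat.exists_eq_add_of_le' hV
  set W := ∑ i, ∑ j, dissipation L y i j with hW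
  have hw := dissipation_nonneg hnonneg y
  have hW0 : 0 ≤ W := sum_nonneg fun i _ => sum_nonneg fun j _ => hw i j
  have hD (i j : V) : (y i - y j) ^ 2 ≤ (m + 3) * W / (4 * ν ^ 2) := by
    obtain ⟨p, hp⟩ := (hG.preconnected i j).exists_isPath
    have h := SimpleGraph.Walk.IsPath.sq_sub_le_energy y (dissipation L y) (2 * ν ^ 2) hw
      (two_mul_sq_le_dissipation hν hnonneg hdiag hadj y) p hp
    have hlen : (p.length : ℝ) ≤ m + 3 := by
      have := hp.length_lt
      exact_mod_cast (by omega : p.length ≤ m + 3)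
    have hle : ∑ a ∈ p.support.toFinset, ∑ b ∈ p.support.toFinset, dissipation L y a b ≤ W :=
      (sum_le_sum fun a _ => sum_le_sum_of_subset_of_nonneg (subset_univ _)
        fun b _ _ => hw a b).trans
        (sum_le_sum_of_subset_of_nonneg (subset_univ _)
          fun a _ _ => sum_nonneg fun b _ => hw a b)
    rw [le_div_iff₀ (by positivity)]
    have := mul_le_mul hlen hle (sum_nonneg fun a _ => sum_nonneg fun b _ => hw a b)
      (by positivity)
    linarith
  have hpop := four_mul_sum_sq_le_card_mul y hy _ hD
  rw [hm, show m + 4 - 1 = 2 + (m + 1) by omega, pow_add]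
  rw [hm] at hpop
  push_cast at hpop
  have hnum : ((m : ℝ) + 4) * (m + 3) * ν ^ (m + 1) ≤ 4 := by
    have h1 : ((m : ℝ) + 4) * (m + 3) ≤ 4 * 3 ^ (m + 1) := by
      exact_mod_cast add_four_mul_add_three_le_four_mul_three_pow m
    calc ((m : ℝ) + 4) * (m + 3) * ν ^ (m + 1)
        ≤ 4 * 3 ^ (m + 1) * (1 / 3) ^ (m + 1) := by gcongr
      _ = 4 := by rw [mul_assoc, ← mul_pow]; norm_num
  calc 4 * (ν ^ 2 * ν ^ (m + 1)) * ∑ i, y i ^ 2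
      = ν ^ 2 * ν ^ (m + 1) * (4 * ∑ i, y i ^ 2) := by ring
    _ ≤ ν ^ 2 * ν ^ (m + 1) * ((m + 4) * ((m + 3) * W / (4 * ν ^ 2))) := by gcongr
    _ = ((m + 4) * (m + 3) * ν ^ (m + 1)) * (W / 4) := by field_simp
    _ ≤ 4 * (W / 4) := by gcongr
    _ = W := by ring

/-- Poincaré inequality for graphs with three vertices. -/
lemma four_mul_pow_mul_le_of_eq_three [DecidableEq V] {L : Matrix V V ℝ} {ν : ℝ} (hν : 0 < ν)
    (hnonneg : ∀ i j, 0 ≤ L i j) (hdiag : ∀ i, ν ≤ L i i) {G : SimpleGraph V}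
    (hG : G.Connected) (hadj : ∀ i j, G.Adj i j → ν ≤ L i j) (hV : Fintype.card V = 3)
    (y : V → ℝ) (hy : ∑ i, y i = 0) :
    4 * ν ^ 2 * ∑ i, y i ^ 2 ≤ ∑ i, ∑ j, dissipation L y i j := by
  obtain ⟨k, a, b, hab, ha, hb⟩ := hG.exists_adj_adj_ne hV.ge
  have huniv : (univ : Finset V) = {k, a, b} := by
    refine (eq_of_subset_of_card_le (subset_univ _) ?_).symm
    rw [card_univ, hV, card_insert_of_notMem (by simp [ha.ne, hb.ne]), card_pair hab]
  have hsum (f : V → ℝ) : ∑ i, f i = f k + (f a + f b) := by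
    rw [huniv, sum_insert (by simp [ha.ne, hb.ne]), sum_pair hab]
  have h1 := sum_sq_le_sum_sq_sub y hy (y k)
  have hw := dissipation_nonneg hnonneg y
  have hc := two_mul_sq_le_dissipation hν hnonneg hdiag hadj y
  have h2 := mul_le_mul_of_nonneg_left h1 (by positivity : 0 ≤ 4 * ν ^ 2)
  refine h2.trans ?_
  simp only [hsum, sub_self]
  nlinarith [hc _ _ ha, hc _ _ ha.symm, hc _ _ hb, hc _ _ hb.symm, hw k k, hw a a, hw b b,
    hw a b, hw b a]

/-- Poincaré inequality for the graph with two vertices. -/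
lemma four_mul_mul_le_of_eq_two [DecidableEq V] {L : Matrix V V ℝ} {ν : ℝ}
    (hnonneg : ∀ i j, 0 ≤ L i j) (hrow : ∀ i, ∑ j, L i j = 1) (hcol : ∀ j, ∑ i, L i j = 1)
    (hdiag : ∀ i, ν ≤ L i i) {G : SimpleGraph V} (hG : G.Connected)
    (hadj : ∀ i j, G.Adj i j → ν ≤ L i j) (hV : Fintype.card V = 2)
    (y : V → ℝ) (hy : ∑ i, y i = 0) :
    4 * ν * ∑ i, y i ^ 2 ≤ ∑ i, ∑ j, dissipation L y i j := by
  have : Nontrivial V := Fintype.one_lt_card_iff_nontrivial.mp (by omega)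
  obtain ⟨a⟩ := hG.nonempty
  obtain ⟨b, hab⟩ := hG.preconnected.exists_adj_of_nontrivial a
  have huniv : (univ : Finset V) = {a, b} := by
    refine (eq_of_subset_of_card_le (subset_univ _) ?_).symm
    rw [card_univ, hV, card_pair hab.ne]
  have hsum (f : V → ℝ) : ∑ i, f i = f a + f b := by rw [huniv, sum_pair hab.ne]
  have h1 := hrow a
  have h2 := hrow b
  have h3 := hcol a
  have h4 := hadj a b hab
  have h5 := hdiag a
  have h6 := hnonneg a b
  have h7 := hnonneg a a
  rw [hsum] at h1 h2 h3 hy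
  have hyb : y b = - y a := by linarith
  have hLaa : L a a = 1 - L a b := by linarith
  have hLba : L b a = L a b := by linarith
  have hLbb : L b b = 1 - L a b := by linarith
  rw [hLaa] at h5 h7
  simp only [hsum, dissipation, hyb, hLaa, hLba, hLbb]
  have key : ν ≤ 2 * (L a b * (1 - L a b)) := by
    rcases le_total (L a b) (1 / 2) with h | h <;> nlinarith
  nlinarith [mul_le_mul_of_nonneg_right key (sq_nonneg (y a))]

/-- One round of averaging contracts zero-sum vectors in the Euclidean norm. -/
lemma sum_sq_mulVec_le [DecidableEq V] {L : Matrix V V ℝ} {ν : ℝ} (hν : 0 < ν)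
    (hnonneg : ∀ i j, 0 ≤ L i j) (hrow : ∀ i, ∑ j, L i j = 1) (hcol : ∀ j, ∑ i, L i j = 1)
    (hdiag : ∀ i, ν ≤ L i i) {G : SimpleGraph V} (hG : G.Connected)
    (hadj : ∀ i j, G.Adj i j → ν ≤ L i j) (hV : 2 ≤ Fintype.card V) (y : V → ℝ)
    (hy : ∑ i, y i = 0) :
    ∑ i, (L.mulVec y i) ^ 2 ≤ (1 - ν ^ (Fintype.card V - 1)) ^ 2 * ∑ i, y i ^ 2 := by
  have h : 4 * ν ^ (Fintype.card V - 1) * ∑ i, y i ^ 2 ≤ ∑ i, ∑ j, dissipation L y i j := by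
    obtain h2 | h3 | h4 : Fintype.card V = 2 ∨ Fintype.card V = 3 ∨ 4 ≤ Fintype.card V := by
      omega
    · simpa [h2] using four_mul_mul_le_of_eq_two hnonneg hrow hcol hdiag hG hadj h2 y hy
    · simpa [h3] using four_mul_pow_mul_le_of_eq_three hν hnonneg hdiag hG hadj h3 y hy
    · exact four_mul_pow_mul_le_of_four_le hν hnonneg hrow hdiag hG hadj h4 y hy
  rw [sum_dissipation hrow hcol] at h
  have h0 : 0 ≤ ∑ i, y i ^ 2 := sum_nonneg fun i _ => sq_nonneg _
  nlinarith [mul_nonneg (sq_nonneg (ν ^ (Fintype.card V - 1))) h0]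

lemma sum_mulVec_eq {L : Matrix V V ℝ} (hcol : ∀ j, ∑ i, L i j = 1) (y : V → ℝ) :
    ∑ i, L.mulVec y i = ∑ i, y i := by
  simp only [Matrix.mulVec, dotProduct]
  rw [sum_comm]
  simp only [← sum_mul, hcol, one_mul]

lemma pow_mulVec_const [DecidableEq V] {L : Matrix V V ℝ} (hrow : ∀ i, ∑ j, L i j = 1) (c : ℝ)
    (n : ℕ) : (L ^ n).mulVec (fun _ => c) = fun _ => c := by
  induction n with
  | zero => simp
  | succ n ih =>
    rw [pow_succ', ← Matrix.mulVec_mulVec, ih]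
    ext i
    simp [Matrix.mulVec, dotProduct, ← sum_mul, hrow]

/-- Geometric decay of zero-sum vectors under repeated averaging. -/
lemma sum_sq_pow_mulVec_le [DecidableEq V] {L : Matrix V V ℝ} {ν : ℝ} (hν : 0 < ν)
    (hnonneg : ∀ i j, 0 ≤ L i j) (hrow : ∀ i, ∑ j, L i j = 1) (hcol : ∀ j, ∑ i, L i j = 1)
    (hdiag : ∀ i, ν ≤ L i i) {G : SimpleGraph V} (hG : G.Connected)
    (hadj : ∀ i j, G.Adj i j → ν ≤ L i j) (hV : 2 ≤ Fintype.card V) (y : V → ℝ)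
    (hy : ∑ i, y i = 0) (n : ℕ) :
    ∑ i, (L ^ n).mulVec y i = 0 ∧ ∑ i, ((L ^ n).mulVec y i) ^ 2 ≤
      ((1 - ν ^ (Fintype.card V - 1)) ^ n) ^ 2 * ∑ i, y i ^ 2 := by
  induction n with
  | zero => simp [hy]
  | succ n ih =>
    rw [pow_succ' L, ← Matrix.mulVec_mulVec]
    refine ⟨(sum_mulVec_eq hcol _).trans ih.1, ?_⟩
    refine (sum_sq_mulVec_le hν hnonneg hrow hcol hdiag hG hadj hV _ ih.1).trans ?_
    refine (mul_le_mul_of_nonneg_left ih.2 (sq_nonneg _)).trans_eq ?_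
    ring

end Energy


/-- Reward consensus error after `G` rounds, with the constant
`(1 + ν^{-(N-1)})·(1 - ν^(N-1))^G` appearing in Theorems 1 and 2 of the paper. -/
theorem stmt_4 (N : ℕ) (hN : 2 ≤ N) (𝒢 : SimpleGraph (Fin N)) (hconn : 𝒢.Connected)
    (ν : ℝ) (hν : 0 < ν) (L : Matrix (Fin N) (Fin N) ℝ)
    (hnonneg : ∀ i j, 0 ≤ L i j)
    (hrow : ∀ i, ∑ j, L i j = 1)
    (hcol : ∀ j, ∑ i, L i j = 1)
    (hdiag : ∀ i, ν ≤ L i i)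
    (hadj : ∀ i j, 𝒢.Adj i j → ν ≤ L i j)
    (r_max : ℝ) (hr_max : 0 < r_max)
    (r : Fin N → ℝ) (hr : ∀ i, |r i| ≤ r_max) :
    ∀ (G : ℕ) (i : Fin N),
      |((L ^ G).mulVec r) i - (1 / N) * ∑ j, r j|
        ≤ 2 * N * r_max * (1 + (ν ^ (N - 1))⁻¹) * (1 - ν ^ (N - 1)) ^ G := by
  intro G i
  have hN0 : (0 : ℝ) < N := by positivity
  have hcard : Fintype.card (Fin N) = N := Fintype.card_fin N
  set m : ℝ := 1 / N * ∑ j, r j with hm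
  set y : Fin N → ℝ := fun j => r j - m with hy_def
  have hy : ∑ j, y j = 0 := by
    simp only [hy_def, sum_sub_distrib, sum_const, card_univ, hcard, nsmul_eq_mul, hm]
    field_simp
    ring
  have hLy : (L ^ G).mulVec y i = (L ^ G).mulVec r i - m := by
    have : y = r - fun _ => m := rfl
    rw [this, Matrix.mulVec_sub, pow_mulVec_const hrow, Pi.sub_apply]
  rw [← hLy]
  have hdecay := (sum_sq_pow_mulVec_le hν hnonneg hrow hcol hdiag hconn hadj (by omega) y hy G).2
  rw [hcard] at hdecay
  have hν1 : ν ≤ 1 := (hdiag i).trans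
    ((single_le_sum (fun j _ => hnonneg i j) (mem_univ i)).trans (hrow i).le)
  have hq : 0 ≤ (1 - ν ^ (N - 1)) ^ G := pow_nonneg (sub_nonneg.2 (pow_le_one₀ hν.le hν1)) _
  set q := (1 - ν ^ (N - 1)) ^ G
  have hy2 : ∑ j, y j ^ 2 ≤ (N * r_max) ^ 2 := by
    have h1 := sum_sq_le_sum_sq_sub y hy (-m)
    have h2 : ∑ j, (y j - -m) ^ 2 ≤ ∑ _j : Fin N, r_max ^ 2 :=
      sum_le_sum fun j _ => by
        rw [show y j - -m = r j by simp [hy_def]]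
        exact sq_le_sq' (neg_le_of_abs_le (hr j)) (le_of_abs_le (hr j))
    rw [sum_const, card_univ, hcard, nsmul_eq_mul] at h2
    have h3 : (N : ℝ) ≤ N ^ 2 := by exact_mod_cast Nat.le_self_pow two_ne_zero N
    rw [mul_pow]
    exact h1.trans (h2.trans (mul_le_mul_of_nonneg_right h3 (sq_nonneg _)))
  have hbound : |(L ^ G).mulVec y i| ≤ q * (N * r_max) := by
    refine abs_le_of_sq_le_sq ?_ (by positivity)
    rw [mul_pow]
    exact (single_le_sum (f := fun j => ((L ^ G).mulVec y j) ^ 2) (fun j _ => sq_nonneg _)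
      (mem_univ i)).trans (hdecay.trans (mul_le_mul_of_nonneg_left hy2 (sq_nonneg _)))
  have hinv : 0 ≤ (ν ^ (N - 1))⁻¹ := by positivity
  have hpos : 0 ≤ N * r_max * q := by positivity
  nlinarith [mul_nonneg hpos hinv]
end
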